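/- For all τ, τ′ ∈ ℂ with Im τ > 0 and Im τ′ > 0, and all z ∈ ℂ at which Γ(z|τ,τ′) is defined, the elliptic gamma function satisfies the shift equation Γ(z+τ′ | τ,τ′) = −i·e^{−πiτ/6}·η_D(τ)^{−1}·e^{πiz}·θ₁(z|τ)·Γ(z | τ,τ′). -/

import Mathlib

/-- Jacobi theta function `θ_a(z|τ)` for `a = 1,2,3,4`. -/
noncomputable def jTheta (a : ℕ) (z τ : ℂ) : ℂ :=
  match a with
  | 1 => -∑' k : ℤ, Complex.exp ((Real.pi : ℂ) * Complex.I * τ * ((k : ℂ) + 1/2)^2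
          + 2 * (Real.pi : ℂ) * Complex.I * (z + 1/2) * ((k : ℂ) + 1/2))
  | 2 => ∑' k : ℤ, Complex.exp ((Real.pi : ℂ) * Complex.I * τ * ((k : ℂ) + 1/2)^2
          + 2 * (Real.pi : ℂ) * Complex.I * z * ((k : ℂ) + 1/2))
  | 3 => ∑' k : ℤ, Complex.exp ((Real.pi : ℂ) * Complex.I * τ * (k : ℂ)^2
          + 2 * (Real.pi : ℂ) * Complex.I * z * (k : ℂ))
  | 4 => ∑' k : ℤ, Complex.exp ((Real.pi : ℂ) * Complex.I * τ * (k : ℂ)^2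
          + 2 * (Real.pi : ℂ) * Complex.I * (z + 1/2) * (k : ℂ))
  | _ => 0

/-- The elliptic gamma function `Γ(z|τ,τ′)`. -/
noncomputable def ellGamma (z τ τ' : ℂ) : ℂ :=
  ∏' p : ℕ × ℕ,
    (1 - Complex.exp (2 * (Real.pi : ℂ) * Complex.I *
        (((p.1 : ℂ) + 1) * τ + ((p.2 : ℂ) + 1) * τ' - z))) /
    (1 - Complex.exp (2 * (Real.pi : ℂ) * Complex.I *
        ((p.1 : ℂ) * τ + (p.2 : ℂ) * τ' + z)))

/-- The Dedekind eta function `η_D(τ)`. -/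
noncomputable def dedekindEtaD (τ : ℂ) : ℂ :=
  Complex.exp ((Real.pi : ℂ) * Complex.I * τ / 12) *
    ∏' k : ℕ, (1 - Complex.exp (2 * (Real.pi : ℂ) * Complex.I * ((k : ℂ) + 1) * τ))

open Filter Topology

/-- The reciprocal `1 / (q; q)_m` of the finite `q`-Pochhammer symbol, extended by zero to
negative `m`. -/
noncomputable def invQPochhammer (q : ℂ) (m : ℤ) : ℂ :=
  if 0 ≤ m then (∏ k ∈ Finset.range m.toNat, (1 - q ^ (k + 1)))⁻¹ else 0

lemma one_sub_pow_succ_ne_zero {q : ℂ} (hq : ‖q‖ < 1) (k : ℕ) : 1 - q ^ (k + 1) ≠ 0 := by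
  intro h
  have h1 : ‖q ^ (k + 1)‖ < 1 := by
    rw [norm_pow]
    exact pow_lt_one₀ (norm_nonneg q) hq k.succ_ne_zero
  rw [← sub_eq_zero.mp h, norm_one] at h1
  exact lt_irrefl _ h1

lemma invQPochhammer_natCast (q : ℂ) (m : ℕ) :
    invQPochhammer q m = (∏ k ∈ Finset.range m, (1 - q ^ (k + 1)))⁻¹ := by
  simp [invQPochhammer]

lemma invQPochhammer_eq {q : ℂ} (hq : ‖q‖ < 1) (m : ℤ) :
    invQPochhammer q m = (1 - q ^ (m + 1)) * invQPochhammer q (m + 1) := by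
  rcases lt_or_ge m 0 with hm | hm
  · rcases eq_or_ne m (-1) with rfl | hm'
    · simp [invQPochhammer]
    · rw [invQPochhammer, invQPochhammer, if_neg (by lia), if_neg (by lia), mul_zero]
  · lift m to ℕ using hm
    have h := one_sub_pow_succ_ne_zero hq m
    rw [show ((m : ℤ) + 1) = ((m + 1 : ℕ) : ℤ) by push_cast; rfl, zpow_natCast,
      invQPochhammer_natCast, invQPochhammer_natCast, Finset.prod_range_succ, mul_inv,
      mul_comm _ (1 - q ^ (m + 1))⁻¹, mul_inv_cancel_left₀ h]

/-- The finite form of the Jacobi triple product. -/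
lemma hasSum_finite_tripleProduct {q x : ℂ} (hq : ‖q‖ < 1) (hq0 : q ≠ 0) (hx : x ≠ 0)
    {T : ℤ → ℂ} (hT0 : T 0 = 1) (hT : ∀ j, T (j + 1) = -(q ^ j * x) * T j) (n : ℕ) :
    HasSum (fun j : ℤ ↦ invQPochhammer q (n + j) * invQPochhammer q (n - j) * T j)
      ((∏ k ∈ Finset.range n, (1 - x * q ^ k)) * (∏ k ∈ Finset.range n, (1 - q / x * q ^ k)) *
        invQPochhammer q ((2 * n : ℕ) : ℤ)) := by
  induction n with
  | zero =>
    convert hasSum_single (0 : ℤ) ?_ using 1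
    · simp [invQPochhammer, hT0]
    · intro j hj
      rcases lt_or_gt_of_ne hj with h | h
      · rw [invQPochhammer, if_neg (by push_cast; lia)]; simp
      · rw [mul_assoc, mul_left_comm, invQPochhammer, if_neg (by push_cast; lia)]; simp
  | succ n ih =>
    have h1 := (Equiv.subRight (1 : ℤ)).hasSum_iff.mpr ih
    have h2 := (Equiv.addRight (1 : ℤ)).hasSum_iff.mpr ih
    have h3 := (((ih.mul_left (1 + q ^ (2 * n + 1))).sub (h1.mul_left (x * q ^ n))).sub
      (h2.mul_left (q ^ (n + 1) / x))).mul_left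
        ((1 - q ^ (2 * n + 1))⁻¹ * (1 - q ^ (2 * n + 2))⁻¹)
    have e1 := one_sub_pow_succ_ne_zero hq (2 * n)
    have e2 := one_sub_pow_succ_ne_zero hq (2 * n + 1)
    rw [show 2 * n + 1 + 1 = 2 * n + 2 by ring] at e2
    convert h3 using 1
    · rfl
    · funext j
      simp only [Function.comp_apply, Equiv.subRight_apply, Equiv.coe_addRight]
      have a1 := invQPochhammer_eq hq (n + j)
      have a2 := invQPochhammer_eq hq (n - j)
      have a3 := invQPochhammer_eq hq (n + (j - 1))
      have a4 := invQPochhammer_eq hq (n - (j + 1))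
      have t1 := hT (j - 1)
      have t2 := hT j
      rw [show (n : ℤ) + (j - 1) + 1 = n + j by ring] at a3
      rw [show (n : ℤ) - (j + 1) + 1 = n - j by ring] at a4
      rw [sub_add_cancel] at t1
      rw [show (n : ℤ) - (j - 1) = n - j + 1 by ring, ← add_assoc (n : ℤ) j 1, a3, a4, a1, a2, t2,
        show ((n + 1 : ℕ) : ℤ) + j = n + j + 1 by push_cast; ring,
        show ((n + 1 : ℕ) : ℤ) - j = n - j + 1 by push_cast; ring]
      generalize invQPochhammer q (n + j + 1) = A
      generalize invQPochhammer q (n - j + 1) = B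
      have t3 : x * T (j - 1) = -(q / q ^ j) * T j := by
        rw [t1, zpow_sub_one₀ hq0]
        have := zpow_ne_zero j hq0
        field_simp
      rw [← mul_assoc, mul_assoc]
      rw [show x * q ^ n * ((1 - q ^ ((n : ℤ) + j)) * ((1 - q ^ ((n : ℤ) + j + 1)) * A) * B
          * T (j - 1)) = q ^ n * ((1 - q ^ ((n : ℤ) + j)) * ((1 - q ^ ((n : ℤ) + j + 1)) * A) * B)
          * (x * T (j - 1)) by ring, t3]
      have hj := zpow_ne_zero j hq0
      rw [zpow_add_one₀ hq0, zpow_add_one₀ hq0, zpow_add₀ hq0, zpow_sub₀ hq0, zpow_natCast]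
      rw [eq_comm, mul_assoc, inv_mul_eq_iff_eq_mul₀ e1, inv_mul_eq_iff_eq_mul₀ e2]
      rw [pow_succ q (2 * n), pow_add q (2 * n) 2, pow_mul' q 2 n, pow_succ q n]
      generalize q ^ j = J at *
      generalize q ^ n = N at *
      field_simp
      ring
    · rw [Finset.prod_range_succ, Finset.prod_range_succ]
      have b1 := invQPochhammer_eq hq ((2 * n : ℕ) : ℤ)
      have b2 := invQPochhammer_eq hq ((2 * n + 1 : ℕ) : ℤ)
      rw [show (((2 * n : ℕ) : ℤ) + 1) = ((2 * n + 1 : ℕ) : ℤ) by push_cast; ring] at b1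
      rw [show (((2 * n + 1 : ℕ) : ℤ) + 1) = ((2 * (n + 1) : ℕ) : ℤ) by push_cast; ring] at b2
      rw [b1, b2, zpow_natCast, zpow_natCast, show 2 * (n + 1) = 2 * n + 2 by ring]
      rw [eq_comm, mul_assoc, inv_mul_eq_iff_eq_mul₀ e1, inv_mul_eq_iff_eq_mul₀ e2]
      field_simp
      ring

lemma summable_norm_mul_pow {q : ℂ} (hq : ‖q‖ < 1) (c : ℂ) :
    Summable fun k : ℕ ↦ ‖-(c * q ^ k)‖ := by
  simp only [norm_neg, norm_mul, norm_pow]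
  exact (summable_geometric_of_lt_one (norm_nonneg q) hq).mul_left _

lemma multipliable_one_sub_mul_pow {q : ℂ} (hq : ‖q‖ < 1) (c : ℂ) :
    Multipliable fun k : ℕ ↦ 1 - c * q ^ k := by
  simpa only [sub_eq_add_neg] using multipliable_one_add_of_summable (summable_norm_mul_pow hq c)

lemma tprod_one_sub_pow_succ_ne_zero {q : ℂ} (hq : ‖q‖ < 1) :
    ∏' k : ℕ, (1 - q ^ (k + 1)) ≠ 0 := by
  have h := tprod_one_add_ne_zero_of_summable (f := fun k : ℕ ↦ -(q * q ^ k)) (fun k ↦ by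
    rw [← pow_succ', ← sub_eq_add_neg]
    exact one_sub_pow_succ_ne_zero hq k) (summable_norm_mul_pow hq q)
  simpa only [← pow_succ', ← sub_eq_add_neg] using h

lemma tendsto_invQPochhammer {q : ℂ} (hq : ‖q‖ < 1) :
    Tendsto (invQPochhammer q) atTop (𝓝 (∏' k : ℕ, (1 - q ^ (k + 1)))⁻¹) := by
  have h := multipliable_one_sub_mul_pow hq q
  simp only [← pow_succ'] at h
  have h1 := h.hasProd.tendsto_prod_nat.inv₀ (tprod_one_sub_pow_succ_ne_zero hq)
  refine (h1.comp (tendsto_atTop_atTop.mpr fun b ↦ ⟨b, fun a h ↦ by lia⟩ :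
    Tendsto Int.toNat atTop atTop)).congr' ?_
  filter_upwards [eventually_ge_atTop 0] with m hm
  simp [invQPochhammer, hm]

lemma exists_norm_invQPochhammer_le {q : ℂ} (hq : ‖q‖ < 1) :
    ∃ C, ∀ m, ‖invQPochhammer q m‖ ≤ C := by
  have h := (tendsto_invQPochhammer hq).comp tendsto_natCast_atTop_atTop
  obtain ⟨C, hC⟩ := h.norm.bddAbove_range
  refine ⟨C, fun m ↦ ?_⟩
  rcases lt_or_ge m 0 with hm | hm
  · rw [invQPochhammer, if_neg (by lia), norm_zero]
    exact (norm_nonneg _).trans (hC ⟨0, rfl⟩)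
  · lift m to ℕ using hm
    exact hC ⟨m, rfl⟩

/-- The Jacobi triple product identity, for a bilateral sequence `T` satisfying the recurrence of
`(-1) ^ j * q ^ (j * (j - 1) / 2) * x ^ j`. -/
lemma tsum_eq_tripleProduct {q x : ℂ} (hq : ‖q‖ < 1) (hq0 : q ≠ 0) (hx : x ≠ 0)
    {T : ℤ → ℂ} (hT0 : T 0 = 1) (hT : ∀ j, T (j + 1) = -(q ^ j * x) * T j) (hs : Summable T) :
    ∑' j, T j = (∏' k : ℕ, (1 - q ^ (k + 1))) * (∏' k : ℕ, (1 - x * q ^ k)) *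
      ∏' k : ℕ, (1 - q / x * q ^ k) := by
  obtain ⟨C, hC⟩ := exists_norm_invQPochhammer_le hq
  have hQ := tprod_one_sub_pow_succ_ne_zero hq
  have hR := tendsto_invQPochhammer hq
  set Q := ∏' k : ℕ, (1 - q ^ (k + 1))
  have hn : Tendsto (fun n : ℕ ↦ (n : ℤ)) atTop atTop := tendsto_natCast_atTop_atTop
  have hlim := tendsto_tsum_of_dominated_convergence (𝓕 := atTop)
    (f := fun (n : ℕ) (j : ℤ) ↦ invQPochhammer q (n + j) * invQPochhammer q (n - j) * T j)
    (g := fun j ↦ Q⁻¹ * Q⁻¹ * T j) (bound := fun j ↦ C * C * ‖T j‖) (hs.norm.mul_left _)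
    (fun j ↦ ((hR.comp (tendsto_atTop_add_const_right _ j hn)).mul
      (hR.comp (tendsto_atTop_add_const_right _ (-j) hn))).mul_const _)
    (Eventually.of_forall fun n j ↦ by
      rw [norm_mul, norm_mul]
      have hC0 : 0 ≤ C := (norm_nonneg _).trans (hC 0)
      gcongr <;> apply hC)
  have hlim' := ((multipliable_one_sub_mul_pow hq x).hasProd.tendsto_prod_nat.mul
    (multipliable_one_sub_mul_pow hq (q / x)).hasProd.tendsto_prod_nat).mul
    (hR.comp (hn.comp (tendsto_id.const_mul_atTop' (show 0 < 2 by norm_num))))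
  have h := tendsto_nhds_unique hlim (hlim'.congr fun n ↦
    (hasSum_finite_tripleProduct hq hq0 hx hT0 hT n).tsum_eq.symm)
  rw [tsum_mul_left] at h
  generalize ∏' k : ℕ, (1 - x * q ^ k) = A at h ⊢
  generalize ∏' k : ℕ, (1 - q / x * q ^ k) = B at h ⊢
  field_simp at h
  rw [h]

lemma summable_norm_mul_pow_mul_pow {q p : ℂ} (hq : ‖q‖ < 1) (hp : ‖p‖ < 1) (c : ℂ) :
    Summable fun k : ℕ × ℕ ↦ ‖-(c * (q ^ k.1 * p ^ k.2))‖ := by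
  simp only [norm_neg, norm_mul, norm_pow]
  exact ((summable_geometric_of_lt_one (norm_nonneg q) hq).mul_of_nonneg
    (summable_geometric_of_lt_one (norm_nonneg p) hp) (fun _ ↦ by positivity)
    (fun _ ↦ by positivity)).mul_left _

lemma multipliable_one_sub_mul_pow_mul_pow {q p : ℂ} (hq : ‖q‖ < 1) (hp : ‖p‖ < 1) (c : ℂ) :
    Multipliable fun k : ℕ × ℕ ↦ 1 - c * (q ^ k.1 * p ^ k.2) := by
  simpa only [sub_eq_add_neg] using
    multipliable_one_add_of_summable (summable_norm_mul_pow_mul_pow hq hp c)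

lemma tprod_one_sub_mul_pow_mul_pow_ne_zero {q p : ℂ} (hq : ‖q‖ < 1) (hp : ‖p‖ < 1) {c : ℂ}
    (hc : ∀ k k' : ℕ, 1 - c * (q ^ k * p ^ k') ≠ 0) :
    ∏' k : ℕ × ℕ, (1 - c * (q ^ k.1 * p ^ k.2)) ≠ 0 := by
  simpa only [sub_eq_add_neg] using tprod_one_add_ne_zero_of_summable
    (fun k : ℕ × ℕ ↦ by simpa only [sub_eq_add_neg] using hc k.1 k.2)
    (summable_norm_mul_pow_mul_pow hq hp c)

/-- Splitting off the factors with vanishing exponent of `p`. -/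
lemma tprod_one_sub_mul_pow_mul_pow {q p : ℂ} (hq : ‖q‖ < 1) (hp : ‖p‖ < 1) (c : ℂ) :
    ∏' k : ℕ × ℕ, (1 - c * (q ^ k.1 * p ^ k.2)) =
      (∏' k : ℕ, (1 - c * q ^ k)) * ∏' k : ℕ × ℕ, (1 - c * p * (q ^ k.1 * p ^ k.2)) := by
  have hfib (d : ℂ) (k : ℕ) : Multipliable fun l : ℕ ↦ 1 - d * (q ^ k * p ^ l) := by
    simpa only [mul_assoc] using multipliable_one_sub_mul_pow hp (d * q ^ k)
  have h (d : ℂ) := (multipliable_one_sub_mul_pow_mul_pow hq hp d).hasProd.prod_fiberwise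
    fun k ↦ (hfib d k).hasProd
  have hshift (k l : ℕ) : 1 - c * (q ^ k * p ^ (l + 1)) = 1 - c * p * (q ^ k * p ^ l) := by
    ring
  rw [← ((multipliable_one_sub_mul_pow hq c).hasProd.mul (h (c * p))).tprod_eq, ← (h c).tprod_eq]
  refine tprod_congr fun k ↦ ?_
  rw [tprod_eq_zero_mul' (by simpa only [hshift] using hfib (c * p) k)]
  simp only [hshift, pow_zero, mul_one]

lemma ellGamma_eq_div {z τ τ' : ℂ} (hq : ‖Complex.exp (2 * Real.pi * Complex.I * τ)‖ < 1)
    (hp : ‖Complex.exp (2 * Real.pi * Complex.I * τ')‖ < 1)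
    (hdef : ∀ k k' : ℕ, 1 - Complex.exp (2 * Real.pi * Complex.I * z) *
      (Complex.exp (2 * Real.pi * Complex.I * τ) ^ k *
        Complex.exp (2 * Real.pi * Complex.I * τ') ^ k') ≠ 0) :
    ellGamma z τ τ' =
      (∏' k : ℕ × ℕ, (1 - Complex.exp (2 * Real.pi * Complex.I * (τ + τ' - z)) *
        (Complex.exp (2 * Real.pi * Complex.I * τ) ^ k.1 *
          Complex.exp (2 * Real.pi * Complex.I * τ') ^ k.2))) /
      ∏' k : ℕ × ℕ, (1 - Complex.exp (2 * Real.pi * Complex.I * z) *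
        (Complex.exp (2 * Real.pi * Complex.I * τ) ^ k.1 *
          Complex.exp (2 * Real.pi * Complex.I * τ') ^ k.2)) := by
  rw [← (multipliable_one_sub_mul_pow_mul_pow hq hp _).tprod_div₀
    (multipliable_one_sub_mul_pow_mul_pow hq hp _)
    (tprod_one_sub_mul_pow_mul_pow_ne_zero hq hp hdef), ellGamma]
  refine tprod_congr fun k ↦ ?_
  simp only [← Complex.exp_nat_mul, ← Complex.exp_add]
  congr 4 <;> ring

lemma norm_exp_two_pi_I_mul_lt_one {τ : ℂ} (hτ : 0 < τ.im) :
    ‖Complex.exp (2 * Real.pi * Complex.I * τ)‖ < 1 := by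
  simpa [Complex.norm_exp, mul_assoc] using mul_pos Real.pi_pos hτ

/-- Jacobi's product formula for `θ₁`. -/
lemma jTheta_one_eq (z : ℂ) {τ : ℂ} (hτ : 0 < τ.im) :
    jTheta 1 z τ = Complex.I * Complex.exp (Real.pi * Complex.I * τ / 4 - Real.pi * Complex.I * z) *
      (∏' k : ℕ, (1 - Complex.exp (2 * Real.pi * Complex.I * τ) ^ (k + 1))) *
      (∏' k : ℕ, (1 - Complex.exp (2 * Real.pi * Complex.I * z) *
        Complex.exp (2 * Real.pi * Complex.I * τ) ^ k)) *
      ∏' k : ℕ, (1 - Complex.exp (2 * Real.pi * Complex.I * (τ - z)) *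
        Complex.exp (2 * Real.pi * Complex.I * τ) ^ k) := by
  have h := tsum_eq_tripleProduct (norm_exp_two_pi_I_mul_lt_one hτ) (Complex.exp_ne_zero _)
    (x := Complex.exp (2 * Real.pi * Complex.I * z)) (Complex.exp_ne_zero _)
    (T := fun j ↦ jacobiTheta₂_term j (z + 1 / 2 - τ / 2) τ) (by simp [jacobiTheta₂_term])
    (fun j ↦ by
      rw [← Complex.exp_int_mul, jacobiTheta₂_term, jacobiTheta₂_term, ← Complex.exp_add,
        ← neg_one_mul, ← Complex.exp_pi_mul_I, ← Complex.exp_add, ← Complex.exp_add]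
      congr 1
      push_cast
      ring)
    ((summable_jacobiTheta₂_term_iff _ _).mpr hτ)
  rw [← Complex.exp_sub, ← mul_sub] at h
  have hterm (j : ℤ) : Complex.exp (Real.pi * Complex.I * τ * (((j - 1 : ℤ) : ℂ) + 1 / 2) ^ 2 +
      2 * Real.pi * Complex.I * (z + 1 / 2) * (((j - 1 : ℤ) : ℂ) + 1 / 2)) =
      -Complex.I * Complex.exp (Real.pi * Complex.I * τ / 4 - Real.pi * Complex.I * z) *
        jacobiTheta₂_term j (z + 1 / 2 - τ / 2) τ := by
    rw [← Complex.exp_neg_pi_div_two_mul_I, jacobiTheta₂_term, ← Complex.exp_add,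
      ← Complex.exp_add]
    congr 1
    push_cast
    ring
  rw [jTheta, ← (Equiv.subRight (1 : ℤ)).tsum_eq]
  simp only [Equiv.subRight_apply, hterm]
  rw [tsum_mul_left, h]
  ring

/-- Shift equation for the elliptic gamma function:
`Γ(z+τ′|τ,τ′) = −i·e^{−πiτ/6}·η_D(τ)⁻¹·e^{πiz}·θ₁(z|τ)·Γ(z|τ,τ′)`. -/
theorem ellGamma_shift (τ τ' : ℂ) (hτ : 0 < τ.im) (hτ' : 0 < τ'.im) (z : ℂ)
    (hdef : ∀ k k' : ℕ,
      1 - Complex.exp (2 * (Real.pi : ℂ) * Complex.I * ((k : ℂ)*τ + (k' : ℂ)*τ' + z)) ≠ 0) :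
    ellGamma (z + τ') τ τ'
      = -Complex.I * Complex.exp (-((Real.pi : ℂ) * Complex.I * τ / 6)) * (dedekindEtaD τ)⁻¹ *
          Complex.exp ((Real.pi : ℂ) * Complex.I * z) * jTheta 1 z τ * ellGamma z τ τ' := by
  have hq := norm_exp_two_pi_I_mul_lt_one hτ
  have hp := norm_exp_two_pi_I_mul_lt_one hτ'
  have hz (k k' : ℕ) : 1 - Complex.exp (2 * Real.pi * Complex.I * z) *
      (Complex.exp (2 * Real.pi * Complex.I * τ) ^ k *
        Complex.exp (2 * Real.pi * Complex.I * τ') ^ k') ≠ 0 := by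
    convert hdef k k' using 2
    simp only [← Complex.exp_nat_mul, ← Complex.exp_add]
    congr 1
    ring
  have hexp : Complex.exp (2 * Real.pi * Complex.I * (z + τ')) =
      Complex.exp (2 * Real.pi * Complex.I * z) * Complex.exp (2 * Real.pi * Complex.I * τ') := by
    rw [← Complex.exp_add, mul_add]
  have hexp' : Complex.exp (2 * Real.pi * Complex.I * (τ - z)) *
      Complex.exp (2 * Real.pi * Complex.I * τ') =
        Complex.exp (2 * Real.pi * Complex.I * (τ + τ' - z)) := by
    rw [← Complex.exp_add]
    ring_nf
  have hz' (k k' : ℕ) : 1 - Complex.exp (2 * Real.pi * Complex.I * (z + τ')) *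
      (Complex.exp (2 * Real.pi * Complex.I * τ) ^ k *
        Complex.exp (2 * Real.pi * Complex.I * τ') ^ k') ≠ 0 := by
    convert hz k (k' + 1) using 2
    rw [hexp]
    ring
  have hη : dedekindEtaD τ = Complex.exp (Real.pi * Complex.I * τ / 12) *
      ∏' k : ℕ, (1 - Complex.exp (2 * Real.pi * Complex.I * τ) ^ (k + 1)) := by
    rw [dedekindEtaD]
    congr 1
    refine tprod_congr fun k ↦ ?_
    rw [← Complex.exp_nat_mul]
    congr 2
    push_cast
    ring
  have hpref : Complex.exp (-(Real.pi * Complex.I * τ / 6)) *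
      (Complex.exp (Real.pi * Complex.I * τ / 12))⁻¹ * Complex.exp (Real.pi * Complex.I * z) *
      Complex.exp (Real.pi * Complex.I * τ / 4 - Real.pi * Complex.I * z) = 1 := by
    rw [← Complex.exp_neg, ← Complex.exp_add, ← Complex.exp_add, ← Complex.exp_add,
      ← Complex.exp_zero]
    congr 1
    ring
  have hden := tprod_one_sub_mul_pow_mul_pow_ne_zero hq hp hz
  have hnum := tprod_one_sub_mul_pow_mul_pow hq hp (Complex.exp (2 * Real.pi * Complex.I * (τ - z)))
  have hsplit := tprod_one_sub_mul_pow_mul_pow hq hp (Complex.exp (2 * Real.pi * Complex.I * z))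
  have hQ := tprod_one_sub_pow_succ_ne_zero hq
  rw [hexp'] at hnum
  rw [← hexp] at hsplit
  rw [ellGamma_eq_div hq hp hz, ellGamma_eq_div hq hp hz',
    show τ + τ' - (z + τ') = τ - z by ring, hnum, jTheta_one_eq z hτ, hη, mul_inv]
  rw [hsplit] at hden ⊢
  generalize (∏' k : ℕ × ℕ, (1 - Complex.exp (2 * Real.pi * Complex.I * (z + τ')) *
      (Complex.exp (2 * Real.pi * Complex.I * τ) ^ k.1 *
        Complex.exp (2 * Real.pi * Complex.I * τ') ^ k.2))) = D at *
  generalize (∏' k : ℕ, (1 - Complex.exp (2 * Real.pi * Complex.I * z) *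
      Complex.exp (2 * Real.pi * Complex.I * τ) ^ k)) = X at *
  generalize (∏' k : ℕ, (1 - Complex.exp (2 * Real.pi * Complex.I * τ) ^ (k + 1))) = Q at *
  have hX := left_ne_zero_of_mul hden
  generalize (∏' k : ℕ × ℕ, (1 - Complex.exp (2 * Real.pi * Complex.I * (τ + τ' - z)) *
      (Complex.exp (2 * Real.pi * Complex.I * τ) ^ k.1 *
        Complex.exp (2 * Real.pi * Complex.I * τ') ^ k.2))) = N at *
  generalize (∏' k : ℕ, (1 - Complex.exp (2 * Real.pi * Complex.I * (τ - z)) *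
      Complex.exp (2 * Real.pi * Complex.I * τ) ^ k)) = Y at *
  have e1 : (X * D)⁻¹ * X = D⁻¹ := by field_simp
  have e2 : Q⁻¹ * Q = 1 := inv_mul_cancel₀ hQ
  calc Y * N / D
      = -Complex.I ^ 2 * 1 * 1 * D⁻¹ * Y * N := by
        rw [Complex.I_sq]
        ring
    _ = _ := by
        rw [← e1]
        nth_rewrite 1 [← hpref]
        rw [← e2]
        ring
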